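/- For every ε > 0 there exists N such that for all n ≥ N divisible by 3 the following holds: if A ⊆ {0,1}^n is a set of 0–1 vectors each of weight exactly n/3 that contains no equilateral triangle (no three distinct pairwise Hamming-equidistant elements), then |A| ≤ (Θ(C)/3 + ε)^n · |B_{n/3}|, where B_{n/3} is the set of all 0–1 vectors of length n of weight n/3 and Θ(C) is the capset capacity. -/

import Mathlib

/-- The weight of a 0–1 vector: the number of coordinates equal to 1. -/
def weight {n : ℕ} (x : Fin n → Bool) : ℕ :=
  (Finset.univ.filter fun i => x i = true).card

/-- A capset in `(ZMod 3)^n`: no three elements, not all equal, summing to zero. -/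
def IsCapset {n : ℕ} (S : Finset (Fin n → ZMod 3)) : Prop :=
  ∀ x ∈ S, ∀ y ∈ S, ∀ z ∈ S, x + y + z = 0 → x = y ∧ y = z

/-- `C_n`, the size of the largest capset in `(ZMod 3)^n`. -/
noncomputable def capsetMax (n : ℕ) : ℕ :=
  sSup {k | ∃ S : Finset (Fin n → ZMod 3), IsCapset S ∧ S.card = k}

/-- The capset capacity `Θ(C) = limsup (C_n)^(1/n)`. -/
noncomputable def capsetCapacity : ℝ :=
  Filter.limsup (fun n : ℕ => (capsetMax n : ℝ) ^ ((1 : ℝ) / n)) Filter.atTop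

lemma card_le_three_pow {n : ℕ} (S : Finset (Fin n → ZMod 3)) : S.card ≤ 3 ^ n := by
  simpa [Fintype.card_pi, ZMod.card] using Finset.card_le_univ S

lemma IsCapset.card_le_capsetMax {n : ℕ} {S : Finset (Fin n → ZMod 3)} (hS : IsCapset S) :
    S.card ≤ capsetMax n :=
  le_csSup ⟨3 ^ n, by rintro k ⟨T, -, rfl⟩; exact card_le_three_pow T⟩ ⟨S, hS, rfl⟩

lemma capsetMax_le (n : ℕ) : capsetMax n ≤ 3 ^ n :=
  csSup_le ⟨0, ∅, by simp [IsCapset], rfl⟩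
    (by rintro k ⟨T, -, rfl⟩; exact card_le_three_pow T)

lemma capsetMax_rpow_le (n : ℕ) : (capsetMax n : ℝ) ^ ((1 : ℝ) / n) ≤ 3 := by
  rcases eq_or_ne n 0 with rfl | hn
  · simp
  calc (capsetMax n : ℝ) ^ ((1 : ℝ) / n) ≤ ((3 : ℝ) ^ n) ^ ((1 : ℝ) / n) := by
        gcongr
        exact_mod_cast capsetMax_le n
    _ = 3 := by rw [one_div, Real.pow_rpow_inv_natCast (by norm_num) hn]

lemma isBoundedUnder_capsetMax_rpow :
    Filter.IsBoundedUnder (· ≤ ·) Filter.atTop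
      (fun n : ℕ => (capsetMax n : ℝ) ^ ((1 : ℝ) / n)) :=
  Filter.isBoundedUnder_of ⟨3, capsetMax_rpow_le⟩

lemma capsetCapacity_nonneg : 0 ≤ capsetCapacity :=
  Filter.le_limsup_of_frequently_le (Filter.Frequently.of_forall fun n => by positivity)
    isBoundedUnder_capsetMax_rpow

lemma eventually_capsetMax_le_pow {c : ℝ} (hc : capsetCapacity < c) :
    ∀ᶠ n : ℕ in Filter.atTop, (capsetMax n : ℝ) ≤ c ^ n := by
  filter_upwards [Filter.eventually_lt_of_limsup_lt hc isBoundedUnder_capsetMax_rpow,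
    Filter.eventually_ne_atTop 0] with n hn hn0
  calc (capsetMax n : ℝ) = ((capsetMax n : ℝ) ^ ((1 : ℝ) / n)) ^ n := by
        rw [one_div, Real.rpow_inv_natCast_pow (by positivity) hn0]
    _ ≤ c ^ n := by gcongr

/-- The 0–1 vector marking the zero coordinates of a vector over `ZMod 3`. -/
def zeroIndicator {n : ℕ} (x : Fin n → ZMod 3) : Fin n → Bool := fun i => decide (x i = 0)

lemma card_filter_zeroIndicator_eq {n : ℕ} (a : Fin n → Bool) :
    (Finset.univ.filter fun x : Fin n → ZMod 3 => zeroIndicator x = a).card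
      = 2 ^ (n - weight a) := by
  have h : (Finset.univ.filter fun x : Fin n → ZMod 3 => zeroIndicator x = a)
      = Fintype.piFinset (fun i => if a i = true then ({0} : Finset (ZMod 3)) else {1, 2}) := by
    ext x
    simp only [Finset.mem_filter, Finset.mem_univ, true_and, Fintype.mem_piFinset,
      funext_iff, zeroIndicator]
    refine forall_congr' fun i => ?_
    generalize x i = t
    generalize a i = b
    revert t b
    decide
  have h2 (i : Fin n) : (if a i = true then ({0} : Finset (ZMod 3)) else {1, 2}).card
      = if a i = true then 1 else 2 := by
    split_ifs <;> decide
  rw [h, Fintype.card_piFinset, Finset.prod_congr rfl fun i _ => h2 i, Finset.prod_ite]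
  simp only [Finset.prod_const, one_pow, one_mul]
  congr 1
  have := Finset.card_filter_add_card_filter_not (s := (Finset.univ : Finset (Fin n)))
    (fun i => a i = true)
  rw [Finset.card_univ, Fintype.card_fin] at this
  unfold weight
  omega

lemma card_filter_zeroIndicator_mem {n m : ℕ} {A : Finset (Fin n → Bool)}
    (hA : ∀ a ∈ A, weight a = m) :
    (Finset.univ.filter fun x : Fin n → ZMod 3 => zeroIndicator x ∈ A).card
      = A.card * 2 ^ (n - m) := by
  rw [Finset.card_eq_sum_card_fiberwise (f := zeroIndicator) (t := A) (by intro x; simp)]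
  rw [← smul_eq_mul, ← Finset.sum_const]
  refine Finset.sum_congr rfl fun a ha => ?_
  rw [← hA a ha, ← card_filter_zeroIndicator_eq, Finset.filter_filter]
  congr 1
  ext x
  simp only [Finset.mem_filter, Finset.mem_univ, true_and, and_iff_right_iff_imp]
  rintro rfl
  exact ha

lemma hammingDist_zeroIndicator_add {n : ℕ} {x y z : Fin n → ZMod 3} (h : x + y + z = 0) :
    hammingDist (zeroIndicator x) (zeroIndicator y)
        + 2 * (Finset.univ.filter fun i => x i = 0 ∧ y i = 0 ∧ z i = 0).card
      = weight (zeroIndicator x) + weight (zeroIndicator y) := by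
  simp only [hammingDist, weight, Finset.card_filter, Finset.mul_sum,
    ← Finset.sum_add_distrib]
  refine Finset.sum_congr rfl fun i _ => ?_
  have hi : x i + y i + z i = 0 := congrFun h i
  by_cases hx : x i = 0 <;> by_cases hy : y i = 0 <;> simp_all [zeroIndicator]

lemma eq_of_zeroIndicator_eq {n : ℕ} {x y z : Fin n → ZMod 3} (h : x + y + z = 0)
    (hxy : zeroIndicator x = zeroIndicator y) (hyz : zeroIndicator y = zeroIndicator z) :
    x = y ∧ y = z := by
  have key (i : Fin n) : x i = y i ∧ y i = z i := by
    have hi : x i + y i + z i = 0 := congrFun h i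
    have h1 := congrFun hxy i
    have h2 := congrFun hyz i
    simp only [zeroIndicator] at h1 h2
    generalize x i = r at *
    generalize y i = s at *
    generalize z i = t at *
    clear h hxy hyz
    revert r s t
    decide
  exact ⟨funext fun i => (key i).1, funext fun i => (key i).2⟩

lemma isCapset_filter_zeroIndicator_mem {n m : ℕ} {A : Finset (Fin n → Bool)}
    (hA : ∀ a ∈ A, weight a = m)
    (hfree : ¬ ∃ x ∈ A, ∃ y ∈ A, ∃ z ∈ A, x ≠ y ∧ y ≠ z ∧ x ≠ z ∧
      hammingDist x y = hammingDist y z ∧ hammingDist y z = hammingDist z x) :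
    IsCapset (Finset.univ.filter fun x : Fin n → ZMod 3 => zeroIndicator x ∈ A) := by
  intro x hx y hy z hz h
  simp only [Finset.mem_filter, Finset.mem_univ, true_and] at hx hy hz
  have hyzx : y + z + x = 0 := by rw [← h]; ring
  have hzxy : z + x + y = 0 := by rw [← h]; ring
  have e1 := hammingDist_zeroIndicator_add h
  have e2 := hammingDist_zeroIndicator_add hyzx
  have e3 := hammingDist_zeroIndicator_add hzxy
  have c2 : (Finset.univ.filter fun i => y i = 0 ∧ z i = 0 ∧ x i = 0)
      = Finset.univ.filter fun i => x i = 0 ∧ y i = 0 ∧ z i = 0 := by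
    ext i; simp; tauto
  have c3 : (Finset.univ.filter fun i => z i = 0 ∧ x i = 0 ∧ y i = 0)
      = Finset.univ.filter fun i => x i = 0 ∧ y i = 0 ∧ z i = 0 := by
    ext i; simp; tauto
  rw [hA _ hx, hA _ hy] at e1
  rw [hA _ hy, hA _ hz, c2] at e2
  rw [hA _ hz, hA _ hx, c3] at e3
  have d1 : hammingDist (zeroIndicator x) (zeroIndicator y)
      = hammingDist (zeroIndicator y) (zeroIndicator z) := by omega
  have d2 : hammingDist (zeroIndicator y) (zeroIndicator z)
      = hammingDist (zeroIndicator z) (zeroIndicator x) := by omega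
  by_cases h0 : hammingDist (zeroIndicator x) (zeroIndicator y) = 0
  · exact eq_of_zeroIndicator_eq h (hammingDist_eq_zero.1 h0)
      (hammingDist_eq_zero.1 (d1 ▸ h0))
  · refine absurd ⟨_, hx, _, hy, _, hz, ?_, ?_, ?_, d1, d2⟩ hfree
    · exact hammingDist_ne_zero.1 h0
    · exact hammingDist_ne_zero.1 (d1 ▸ h0)
    · exact (hammingDist_ne_zero.1 (d2 ▸ d1 ▸ h0)).symm

lemma card_filter_weight_eq (n m : ℕ) :
    (Finset.univ.filter fun x : Fin n → Bool => weight x = m).card = n.choose m := by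
  have h : (Finset.powersetCard m (Finset.univ : Finset (Fin n))).card = n.choose m := by simp
  rw [← h]
  refine Finset.card_nbij' (fun x => Finset.univ.filter fun i => x i = true)
    (fun s i => decide (i ∈ s)) ?_ ?_ ?_ ?_
  · intro x hx
    simpa [weight, Finset.mem_powersetCard] using Finset.mem_filter.1 hx
  · intro s hs
    exact Finset.mem_filter.2 ⟨Finset.mem_univ _, by simpa [weight] using hs⟩
  · intro x _
    simp
  · intro s _
    simp

lemma choose_mul_two_pow_succ_mul {n k : ℕ} (hk : k < n) :
    (n.choose (k + 1) * 2 ^ (n - (k + 1))) * (2 * (k + 1))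
      = (n.choose k * 2 ^ (n - k)) * (n - k) := by
  have h := Nat.choose_succ_right_eq n k
  have h2 : n - k = (n - (k + 1)) + 1 := by omega
  calc _ = (n.choose (k + 1) * (k + 1)) * (2 ^ (n - (k + 1)) * 2) := by ring
    _ = (n.choose k * (n - k)) * 2 ^ (n - k) := by rw [h, ← pow_succ, ← h2]
    _ = _ := by ring

/-- The mode of the binomial distribution with `3 * m` trials of probability `1 / 3` is `m`. -/
lemma choose_mul_two_pow_le (m : ℕ) {k : ℕ} (hk : k ≤ 3 * m) :
    (3 * m).choose k * 2 ^ (3 * m - k) ≤ (3 * m).choose m * 2 ^ (3 * m - m) := by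
  rcases le_total k m with hkm | hmk
  · induction hkm using Nat.decreasingInduction with
    | self => exact le_rfl
    | of_succ k hlt ih =>
      refine le_trans ?_ (ih (by omega))
      refine Nat.le_of_mul_le_mul_right ?_ (show 0 < 2 * (k + 1) by omega)
      rw [choose_mul_two_pow_succ_mul (by omega)]
      exact Nat.mul_le_mul_left _ (by omega)
  · induction k, hmk using Nat.le_induction with
    | base => exact le_rfl
    | succ k hle ih =>
      refine le_trans ?_ (ih (by omega))
      refine Nat.le_of_mul_le_mul_right ?_ (show 0 < 2 * (k + 1) by omega)
      rw [choose_mul_two_pow_succ_mul (by omega)]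
      exact Nat.mul_le_mul_left _ (by omega)

lemma three_pow_le_choose_mul (m : ℕ) :
    3 ^ (3 * m) ≤ (3 * m + 1) * ((3 * m).choose m * 2 ^ (3 * m - m)) := by
  calc 3 ^ (3 * m) = ∑ k ∈ Finset.range (3 * m + 1), (3 * m).choose k * 2 ^ (3 * m - k) := by
        have h := add_pow 1 2 (3 * m)
        norm_num at h
        rw [h]
        exact Finset.sum_congr rfl fun k _ => mul_comm _ _
    _ ≤ ∑ _k ∈ Finset.range (3 * m + 1), (3 * m).choose m * 2 ^ (3 * m - m) :=
        Finset.sum_le_sum fun k hk =>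
          choose_mul_two_pow_le m (by rw [Finset.mem_range] at hk; omega)
    _ = _ := by simp

lemma card_mul_three_pow_le {n : ℕ} (hn : 3 ∣ n) {A : Finset (Fin n → Bool)}
    (hA : ∀ x ∈ A, weight x = n / 3)
    (hfree : ¬ ∃ x ∈ A, ∃ y ∈ A, ∃ z ∈ A, x ≠ y ∧ y ≠ z ∧ x ≠ z ∧
      hammingDist x y = hammingDist y z ∧ hammingDist y z = hammingDist z x) :
    A.card * 3 ^ n ≤ (n + 1) * capsetMax n *
      (Finset.univ.filter fun x : Fin n → Bool => weight x = n / 3).card := by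
  obtain ⟨m, rfl⟩ := hn
  have hm : 3 * m / 3 = m := by omega
  rw [card_filter_weight_eq]
  rw [hm] at hA ⊢
  have h1 := (isCapset_filter_zeroIndicator_mem hA hfree).card_le_capsetMax
  rw [card_filter_zeroIndicator_mem hA] at h1
  calc A.card * 3 ^ (3 * m)
      ≤ A.card * ((3 * m + 1) * ((3 * m).choose m * 2 ^ (3 * m - m))) := by
        gcongr
        exact three_pow_le_choose_mul m
    _ = (3 * m + 1) * (A.card * 2 ^ (3 * m - m)) * (3 * m).choose m := by ring
    _ ≤ _ := by gcongr

lemma eventually_add_one_mul_pow_le {a b : ℝ} (ha : 0 ≤ a) (hab : a < b) :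
    ∀ᶠ n : ℕ in Filter.atTop, ((n : ℝ) + 1) * a ^ n ≤ b ^ n := by
  have hb : 0 < b := ha.trans_lt hab
  have hr0 : 0 ≤ a / b := by positivity
  have hr1 : a / b < 1 := (div_lt_one hb).2 hab
  have h := (tendsto_self_mul_const_pow_of_lt_one hr0 hr1).add
    (tendsto_pow_atTop_nhds_zero_of_lt_one hr0 hr1)
  rw [add_zero] at h
  filter_upwards [h.eventually_lt_const zero_lt_one] with n hn
  have hbn : 0 < b ^ n := by positivity
  rw [div_pow, ← add_one_mul, ← mul_div_assoc, div_lt_one hbn] at hn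
  exact hn.le

theorem equilateral_free_weight_third_density_bound :
    ∀ ε : ℝ, 0 < ε → ∃ N : ℕ, ∀ n : ℕ, N ≤ n → 3 ∣ n →
      ∀ A : Finset (Fin n → Bool),
        (∀ x ∈ A, weight x = n / 3) →
        (¬ ∃ x ∈ A, ∃ y ∈ A, ∃ z ∈ A, x ≠ y ∧ y ≠ z ∧ x ≠ z ∧
            hammingDist x y = hammingDist y z ∧ hammingDist y z = hammingDist z x) →
        (A.card : ℝ) ≤ (capsetCapacity / 3 + ε) ^ n *
          ((Finset.univ.filter fun x : Fin n → Bool => weight x = n / 3).card : ℝ) := by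
  intro ε hε
  have hcap := capsetCapacity_nonneg
  obtain ⟨N, hN⟩ := Filter.eventually_atTop.1
    ((eventually_capsetMax_le_pow (show capsetCapacity < capsetCapacity + ε by linarith)).and
      (eventually_add_one_mul_pow_le (show 0 ≤ capsetCapacity + ε by linarith)
        (show capsetCapacity + ε < capsetCapacity + 3 * ε by linarith)))
  refine ⟨N, fun n hn h3 A hA hfree => ?_⟩
  obtain ⟨hC, hpow⟩ := hN n hn
  have hmain : (A.card : ℝ) * 3 ^ n ≤ ((n : ℝ) + 1) * capsetMax n *
      ((Finset.univ.filter fun x : Fin n → Bool => weight x = n / 3).card : ℝ) := by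
    exact_mod_cast card_mul_three_pow_le h3 hA hfree
  generalize ((Finset.univ.filter fun x : Fin n → Bool => weight x = n / 3).card) = B at *
  have hsplit : capsetCapacity / 3 + ε = (capsetCapacity + 3 * ε) / 3 := by ring
  rw [hsplit, div_pow, div_mul_eq_mul_div, le_div_iff₀ (by positivity)]
  refine hmain.trans ?_
  gcongr
  exact le_trans (by gcongr) hpow
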